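/- arXiv:1401.7707 — 2 statements merged into one kernel-verified Lean document; each statement's English description precedes it below -/
import Mathlib

section
/- (Theorem B(b)) Let u be a weak stationary solution density and let U be a weak anti-Lyapunov function in 𝒰 with respect to ℒ with essential lower bound ρ_m and essential upper bound ρ_M. Let h, H be sandwich functions for U such that h is continuous and positive on [ρ_m, ρ_M) and H(t) > 0 for all t ∈ (ρ_m, ρ_M). Define H̃(ρ) = H(ρ) ∫_{ρ_m}^{ρ} ds / h(s) for ρ ∈ (ρ_m, ρ_M). Then for every ρ_0 ∈ (ρ_m, ρ_M) and every ρ ∈ [ρ_0, ρ_M), μ(Ω_ρ \ Ω_{ρ_m}) ≥ μ(Ω_{ρ_0} \ Ω_{ρ_m}) · exp(∫_{ρ_0}^{ρ} dt / H̃(t)). -/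
open MeasureTheory

noncomputable section

/-- Euclidean space ℝⁿ. -/
abbrev Eucl (n : ℕ) : Type := EuclideanSpace ℝ (Fin n)

/-- First-order partial derivative `∂ᵢ f`. -/
def pd {n : ℕ} (f : Eucl n → ℝ) (i : Fin n) (x : Eucl n) : ℝ :=
  fderiv ℝ f x (EuclideanSpace.single i 1)

/-- Second-order partial derivative `∂²ᵢⱼ f`. -/
def pd2 {n : ℕ} (f : Eucl n → ℝ) (i j : Fin n) (x : Eucl n) : ℝ :=
  fderiv ℝ (fun y => fderiv ℝ f y (EuclideanSpace.single j 1)) x (EuclideanSpace.single i 1)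

/-- The adjoint Fokker–Planck operator `ℒf = aⁱʲ ∂²ᵢⱼ f + Vⁱ ∂ᵢ f`. -/
def Lop {n : ℕ} (a : Eucl n → Matrix (Fin n) (Fin n) ℝ)
    (V : Eucl n → Fin n → ℝ) (f : Eucl n → ℝ) (x : Eucl n) : ℝ :=
  (∑ i, ∑ j, a x i j * pd2 f i j x) + ∑ i, V x i * pd f i x

/-- The quadratic form `⟨a(x) ∇f(x), ∇f(x)⟩ = ∑ᵢⱼ aⁱʲ ∂ᵢf ∂ⱼf`. -/
def aQuad {n : ℕ} (a : Eucl n → Matrix (Fin n) (Fin n) ℝ)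
    (f : Eucl n → ℝ) (x : Eucl n) : ℝ :=
  ∑ i, ∑ j, a x i j * pd f i x * pd f j x

open Set Filter Topology
open scoped Convolution

/-! ### Mollification of `C²` test functions -/

theorem pd_convolution {n : ℕ} {η g : Eucl n → ℝ} (hη : Continuous η)
    (hg : ContDiff ℝ 1 g) (hc : HasCompactSupport g) (i : Fin n) :
    pd (η ⋆[ContinuousLinearMap.lsmul ℝ ℝ, volume] g) i =
      η ⋆[ContinuousLinearMap.lsmul ℝ ℝ, volume] (pd g i) := by
  funext x
  have h := hc.hasFDerivAt_convolution_right (μ := volume) (ContinuousLinearMap.lsmul ℝ ℝ)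
    hη.locallyIntegrable hg x
  rw [pd, h.fderiv, convolution_precompR_apply _ hη.locallyIntegrable (hc.fderiv ℝ)
    (hg.continuous_fderiv one_ne_zero)]
  rfl

theorem ContDiff.pd {n : ℕ} {f : Eucl n → ℝ} {k m : ℕ∞} (hf : ContDiff ℝ m f)
    (hk : (k : WithTop ℕ∞) + 1 ≤ m) (i : Fin n) : ContDiff ℝ k (pd f i) :=
  (hf.fderiv_right hk).clm_apply contDiff_const

theorem HasCompactSupport.pd {n : ℕ} {f : Eucl n → ℝ} (hf : HasCompactSupport f) (i : Fin n) :
    HasCompactSupport (pd f i) :=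
  hf.fderiv_apply ℝ _

theorem pd2_eq {n : ℕ} (f : Eucl n → ℝ) (i j : Fin n) : pd2 f i j = pd (pd f j) i := rfl

theorem tsupport_pd_subset {n : ℕ} (f : Eucl n → ℝ) (i : Fin n) : tsupport (pd f i) ⊆ tsupport f :=
  tsupport_fderiv_apply_subset ℝ _

theorem Lop_eq_zero_of_notMem_tsupport {n : ℕ} (a : Eucl n → Matrix (Fin n) (Fin n) ℝ)
    (V : Eucl n → Fin n → ℝ) {f : Eucl n → ℝ} {x : Eucl n} (hx : x ∉ tsupport f) :
    Lop a V f x = 0 := by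
  have h1 : ∀ i, pd f i x = 0 := fun i =>
    image_eq_zero_of_notMem_tsupport fun h => hx (tsupport_pd_subset f i h)
  have h2 : ∀ i j, pd2 f i j x = 0 := fun i j =>
    image_eq_zero_of_notMem_tsupport fun h =>
      hx (tsupport_pd_subset f j (tsupport_pd_subset (pd f j) i h))
  simp [Lop, h1, h2]

theorem ContDiffBump.abs_normed_convolution_le {n : ℕ} (φ : ContDiffBump (0 : Eucl n))
    {g : Eucl n → ℝ} (hg : Continuous g) {C : ℝ} (hC : ∀ x, |g x| ≤ C) (x : Eucl n) :
    |(φ.normed volume ⋆[ContinuousLinearMap.lsmul ℝ ℝ, volume] g) x| ≤ 3 * C := by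
  have h := φ.dist_normed_convolution_le (μ := volume) (x₀ := x) (ε := 2 * C)
    hg.aestronglyMeasurable (fun y _ => by
      rw [Real.dist_eq]
      linarith [abs_sub (g y) (g x), hC x, hC y])
  rw [Real.dist_eq] at h
  linarith [abs_sub_abs_le_abs_sub
    ((φ.normed volume ⋆[ContinuousLinearMap.lsmul ℝ ℝ, volume] g) x) (g x), hC x]

theorem abs_Lop_le {n : ℕ} (a : Eucl n → Matrix (Fin n) (Fin n) ℝ) (V : Eucl n → Fin n → ℝ)
    (f : Eucl n → ℝ) (x : Eucl n) {C : ℝ} (h1 : ∀ i, |pd f i x| ≤ C)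
    (h2 : ∀ i j, |pd2 f i j x| ≤ C) :
    |Lop a V f x| ≤ (∑ i, ∑ j, |a x i j| * C) + ∑ i, |V x i| * C := by
  refine (abs_add_le _ _).trans (add_le_add ?_ ?_)
  · refine (Finset.abs_sum_le_sum_abs _ _).trans (Finset.sum_le_sum fun i _ => ?_)
    refine (Finset.abs_sum_le_sum_abs _ _).trans (Finset.sum_le_sum fun j _ => ?_)
    rw [abs_mul]
    exact mul_le_mul_of_nonneg_left (h2 i j) (abs_nonneg _)
  · refine (Finset.abs_sum_le_sum_abs _ _).trans (Finset.sum_le_sum fun i _ => ?_)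
    rw [abs_mul]
    exact mul_le_mul_of_nonneg_left (h1 i) (abs_nonneg _)

theorem exists_pd_bound {n : ℕ} {f : Eucl n → ℝ} (hf : ContDiff ℝ 2 f)
    (hc : HasCompactSupport f) :
    ∃ C, (∀ i x, |pd f i x| ≤ C) ∧ ∀ i j x, |pd2 f i j x| ≤ C := by
  have c1 : ∀ i, ContDiff ℝ 1 (pd f i) := fun i => hf.pd (k := 1) (m := 2) (by norm_num) i
  have c2 : ∀ i j, ContDiff ℝ 0 (pd2 f i j) := fun i j =>
    (c1 j).pd (k := 0) (m := 1) (by norm_num) i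
  have b1 : ∀ i, ∃ C, ∀ x, ‖pd f i x‖ ≤ C := fun i =>
    (hc.pd i).exists_bound_of_continuous (c1 i).continuous
  have b2 : ∀ i j, ∃ C, ∀ x, ‖pd2 f i j x‖ ≤ C := fun i j =>
    ((hc.pd j).pd i).exists_bound_of_continuous (c2 i j).continuous
  choose C1 hC1 using b1
  choose C2 hC2 using b2
  have n1 : ∀ i, 0 ≤ C1 i := fun i => (norm_nonneg _).trans (hC1 i 0)
  have n2 : ∀ i j, 0 ≤ C2 i j := fun i j => (norm_nonneg _).trans (hC2 i j 0)
  refine ⟨(∑ i, C1 i) + ∑ i, ∑ j, C2 i j, fun i x => (hC1 i x).trans ?_,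
    fun i j x => (hC2 i j x).trans ?_⟩
  · have := Finset.single_le_sum (fun i _ => n1 i) (Finset.mem_univ i)
    have : 0 ≤ ∑ i, ∑ j, C2 i j :=
      Finset.sum_nonneg fun i _ => Finset.sum_nonneg fun j _ => n2 i j
    linarith
  · have h1 := Finset.single_le_sum (fun j _ => n2 i j) (Finset.mem_univ j)
    have h2 := Finset.single_le_sum (f := fun i => ∑ j, C2 i j)
      (fun i _ => Finset.sum_nonneg fun j _ => n2 i j) (Finset.mem_univ i)
    have : 0 ≤ ∑ i, C1 i := Finset.sum_nonneg fun i _ => n1 i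
    linarith

theorem ContinuousOn.Lop {n : ℕ} {a : Eucl n → Matrix (Fin n) (Fin n) ℝ}
    {V : Eucl n → Fin n → ℝ} {𝒰 : Set (Eucl n)}
    (ha : ∀ i j, ContinuousOn (fun x => a x i j) 𝒰) (hV : ContinuousOn V 𝒰) {f : Eucl n → ℝ}
    (h1 : ∀ i, ContinuousOn (pd f i) 𝒰) (h2 : ∀ i j, ContinuousOn (pd2 f i j) 𝒰) :
    ContinuousOn (Lop a V f) 𝒰 := by
  refine ContinuousOn.add ?_ ?_
  · exact continuousOn_finsetSum _ fun i _ => continuousOn_finsetSum _ fun j _ =>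
      (ha i j).mul (h2 i j)
  · exact continuousOn_finsetSum _ fun i _ => ((continuousOn_pi.1 hV) i).mul (h1 i)

/-- The weak stationarity identity extends from smooth test functions to `C²` ones. -/
theorem integral_Lop_mul_eq_zero_of_contDiff_two {n : ℕ} {𝒰 : Set (Eucl n)} (hUopen : IsOpen 𝒰)
    {a : Eucl n → Matrix (Fin n) (Fin n) ℝ}
    (ha : ∀ i j, ContinuousOn (fun x => a x i j) 𝒰)
    {V : Eucl n → Fin n → ℝ} (hV : ContinuousOn V 𝒰)
    {u : Eucl n → ℝ} (hu : ContinuousOn u 𝒰)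
    (hu_stat : ∀ f : Eucl n → ℝ, ContDiff ℝ (⊤ : ℕ∞) f → HasCompactSupport f →
      tsupport f ⊆ 𝒰 → (∫ x in 𝒰, Lop a V f x * u x) = 0)
    {f : Eucl n → ℝ} (hf : ContDiff ℝ 2 f) (hc : HasCompactSupport f) (hs : tsupport f ⊆ 𝒰) :
    (∫ x in 𝒰, Lop a V f x * u x) = 0 := by
  obtain ⟨δ, hδ, hδU⟩ := hc.isCompact.exists_cthickening_subset_open hUopen hs
  set K := Metric.cthickening δ (tsupport f) with hK
  have hKc : IsCompact K := hc.isCompact.cthickening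
  have c1 : ∀ i, ContDiff ℝ 1 (pd f i) := fun i => hf.pd (k := 1) (m := 2) (by norm_num) i
  have c2 : ∀ i j, ContDiff ℝ 0 (pd2 f i j) := fun i j =>
    (c1 j).pd (k := 0) (m := 1) (by norm_num) i
  have hr : ∀ k : ℕ, 0 < δ / ((k : ℝ) + 2) := fun k => by positivity
  let φ : ℕ → ContDiffBump (0 : Eucl n) := fun k =>
    ⟨δ / ((k : ℝ) + 2) / 2, δ / ((k : ℝ) + 2), by have := hr k; positivity,
      by have := hr k; linarith⟩
  let F : ℕ → Eucl n → ℝ := fun k =>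
    (φ k).normed volume ⋆[ContinuousLinearMap.lsmul ℝ ℝ, volume] f
  have hrO : Tendsto (fun k => (φ k).rOut) atTop (𝓝 0) := by
    have : Tendsto (fun k : ℕ => (k : ℝ) + 2) atTop atTop :=
      tendsto_atTop_add_const_right _ _ tendsto_natCast_atTop_atTop
    exact tendsto_const_nhds.div_atTop this
  have hηc : ∀ k, Continuous ((φ k).normed volume) := fun k => (φ k).continuous_normed
  have p1 : ∀ k i, pd (F k) i =
      (φ k).normed volume ⋆[ContinuousLinearMap.lsmul ℝ ℝ, volume] (pd f i) := fun k i =>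
    pd_convolution (hηc k) (hf.of_le (by norm_num)) hc i
  have p2 : ∀ k i j, pd2 (F k) i j =
      (φ k).normed volume ⋆[ContinuousLinearMap.lsmul ℝ ℝ, volume] (pd2 f i j) := fun k i j => by
    rw [pd2_eq, p1, pd_convolution (hηc k) (c1 j) (hc.pd j) i, pd2_eq]
  have hFs : ∀ k, ContDiff ℝ (⊤ : ℕ∞) (F k) := fun k =>
    (φ k).hasCompactSupport_normed.contDiff_convolution_left _ (φ k).contDiff_normed
      hf.continuous.locallyIntegrable
  have hFK : ∀ k, tsupport (F k) ⊆ K := by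
    intro k
    refine closure_minimal ?_ Metric.isClosed_cthickening
    intro x hx
    obtain ⟨y, hy, z, hz, rfl⟩ := Set.mem_add.1
      (support_convolution_subset_swap (ContinuousLinearMap.lsmul ℝ ℝ) hx)
    rw [(φ k).support_normed_eq] at hz
    refine Metric.mem_cthickening_of_dist_le _ y _ _ (subset_tsupport _ hy) ?_
    have : ‖z‖ < δ / ((k : ℝ) + 2) := by simpa using hz
    have h3 : δ / ((k : ℝ) + 2) ≤ δ := div_le_self hδ.le (by linarith [k.cast_nonneg (α := ℝ)])
    rw [dist_eq_norm]
    simp only [add_sub_cancel_left]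
    linarith
  have hFc : ∀ k, HasCompactSupport (F k) := fun k =>
    hKc.of_isClosed_subset (isClosed_tsupport _) (hFK k)
  have hcut : ∀ g : Eucl n → ℝ, tsupport g ⊆ K →
      (∫ x in 𝒰, Lop a V g x * u x) = ∫ x in K, Lop a V g x * u x := by
    intro g hg
    refine setIntegral_eq_of_subset_of_forall_sdiff_eq_zero (μ := volume)
      (f := fun x => Lop a V g x * u x) hUopen.measurableSet hδU ?_
    intro x hx
    rw [Lop_eq_zero_of_notMem_tsupport a V fun h => hx.2 (hg h), zero_mul]
  obtain ⟨C, hC1, hC2⟩ := exists_pd_bound hf hc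
  have hlim : Tendsto (fun k => ∫ x in K, Lop a V (F k) x * u x) atTop
      (𝓝 (∫ x in K, Lop a V f x * u x)) := by
    refine tendsto_integral_of_dominated_convergence
      (fun x => ((∑ i, ∑ j, |a x i j| * (3 * C)) + ∑ i, |V x i| * (3 * C)) * |u x|) ?_ ?_ ?_ ?_
    · intro k
      have d1 : ∀ i, ContDiff ℝ 1 (pd (F k) i) := fun i =>
        (hFs k).pd (k := 1) (m := ⊤) (by exact_mod_cast le_top) i
      have d2 : ∀ i j, ContDiff ℝ 0 (pd2 (F k) i j) := fun i j =>
        (d1 j).pd (k := 0) (m := 1) (by norm_num) i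
      exact (((ContinuousOn.Lop ha hV (fun i => (d1 i).continuous.continuousOn)
        (fun i j => (d2 i j).continuous.continuousOn)).mul hu).mono hδU).aestronglyMeasurable
        hKc.measurableSet
    · refine ContinuousOn.integrableOn_compact hKc (ContinuousOn.mono ?_ hδU)
      refine (ContinuousOn.add ?_ ?_).mul hu.abs
      · exact continuousOn_finsetSum _ fun i _ => continuousOn_finsetSum _ fun j _ =>
          (ha i j).abs.mul continuousOn_const
      · exact continuousOn_finsetSum _ fun i _ =>
          ((continuousOn_pi.1 hV) i).abs.mul continuousOn_const
    · intro k
      refine Eventually.of_forall fun x => ?_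
      rw [Real.norm_eq_abs, abs_mul]
      refine mul_le_mul_of_nonneg_right (abs_Lop_le a V _ x ?_ ?_) (abs_nonneg _)
      · intro i
        rw [p1]
        exact (φ k).abs_normed_convolution_le (c1 i).continuous (hC1 i) x
      · intro i j
        rw [p2]
        exact (φ k).abs_normed_convolution_le (c2 i j).continuous (hC2 i j) x
    · refine Eventually.of_forall fun x => Tendsto.mul_const _ ?_
      refine Tendsto.add ?_ ?_
      · refine tendsto_finsetSum _ fun i _ => tendsto_finsetSum _ fun j _ =>
          Tendsto.const_mul _ ?_
        simp_rw [p2]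
        exact ContDiffBump.convolution_tendsto_right_of_continuous hrO (c2 i j).continuous x
      · refine tendsto_finsetSum _ fun i _ => Tendsto.const_mul _ ?_
        simp_rw [p1]
        exact ContDiffBump.convolution_tendsto_right_of_continuous hrO (c1 i).continuous x
  have hz : ∀ k, (∫ x in K, Lop a V (F k) x * u x) = 0 := fun k => by
    rw [← hcut _ (hFK k)]
    exact hu_stat _ (hFs k) (hFc k) ((hFK k).trans hδU)
  simp_rw [hz] at hlim
  rw [hcut f (Metric.self_subset_cthickening _)]
  exact tendsto_nhds_unique hlim tendsto_const_nhds

/-! ### Test functions of the form `φ ∘ U` -/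

theorem contDiff_two_of_hasDerivAt {φ ψ θ : ℝ → ℝ} (hφ : ∀ t, HasDerivAt φ (ψ t) t)
    (hψ : ∀ t, HasDerivAt ψ (θ t) t) (hθ : Continuous θ) : ContDiff ℝ 2 φ := by
  have eφ : deriv φ = ψ := funext fun t => (hφ t).deriv
  have eψ : deriv ψ = θ := funext fun t => (hψ t).deriv
  have h1 : ContDiff ℝ 1 ψ := by
    rw [contDiff_one_iff_deriv]
    exact ⟨fun t => (hψ t).differentiableAt, eψ ▸ hθ⟩
  rw [show (2 : WithTop ℕ∞) = 1 + 1 by norm_num, contDiff_succ_iff_deriv]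
  exact ⟨fun t => (hφ t).differentiableAt, by simp, eφ ▸ h1⟩

theorem ContDiffOn.contDiffAt_pd {n : ℕ} {𝒰 : Set (Eucl n)} (hUopen : IsOpen 𝒰)
    {U : Eucl n → ℝ} (hU : ContDiffOn ℝ 2 U 𝒰) {x : Eucl n} (hx : x ∈ 𝒰) (i : Fin n) :
    ContDiffAt ℝ 1 (_root_.pd U i) x :=
  ((hU.contDiffAt (hUopen.mem_nhds hx)).fderiv_right (m := 1) (by norm_num)).clm_apply
    contDiffAt_const

theorem pd_comp {n : ℕ} {U : Eucl n → ℝ} {φ : ℝ → ℝ} {ψ : ℝ} {x : Eucl n}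
    (hφ : HasDerivAt φ ψ (U x)) (hU : DifferentiableAt ℝ U x) (i : Fin n) :
    pd (fun y => φ (U y)) i x = ψ * pd U i x := by
  have h : HasFDerivAt (fun y => φ (U y)) (ψ • fderiv ℝ U x) x :=
    hφ.comp_hasFDerivAt x hU.hasFDerivAt
  rw [pd, h.fderiv]
  rfl

theorem Filter.EventuallyEq.pd {n : ℕ} {f g : Eucl n → ℝ} {x : Eucl n} (h : f =ᶠ[𝓝 x] g)
    (i : Fin n) : pd f i =ᶠ[𝓝 x] pd g i :=
  (h.fderiv (𝕜 := ℝ)).mono fun y hy => by simp only [_root_.pd, hy]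

theorem Lop_congr {n : ℕ} (a : Eucl n → Matrix (Fin n) (Fin n) ℝ)
    (V : Eucl n → Fin n → ℝ) {f g : Eucl n → ℝ} {x : Eucl n} (h : f =ᶠ[𝓝 x] g) :
    Lop a V f x = Lop a V g x := by
  simp only [Lop, pd2_eq, (h.pd _).eq_of_nhds, ((h.pd _).pd _).eq_of_nhds]

theorem Lop_comp {n : ℕ} (a : Eucl n → Matrix (Fin n) (Fin n) ℝ)
    (V : Eucl n → Fin n → ℝ) {𝒰 : Set (Eucl n)} (hUopen : IsOpen 𝒰)
    {U : Eucl n → ℝ} (hU : ContDiffOn ℝ 2 U 𝒰) {φ ψ θ : ℝ → ℝ}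
    (hφ : ∀ t, HasDerivAt φ (ψ t) t) (hψ : ∀ t, HasDerivAt ψ (θ t) t)
    {x : Eucl n} (hx : x ∈ 𝒰) :
    Lop a V (fun y => φ (U y)) x = ψ (U x) * Lop a V U x + θ (U x) * aQuad a U x := by
  have hUd : ∀ y ∈ 𝒰, DifferentiableAt ℝ U y := fun y hy =>
    (hU.contDiffAt (hUopen.mem_nhds hy)).differentiableAt (by norm_num)
  have e1 : ∀ i, pd (fun y => φ (U y)) i =ᶠ[𝓝 x] fun y => ψ (U y) * pd U i y := fun i =>
    (hUopen.eventually_mem hx).mono fun y hy => pd_comp (hφ _) (hUd y hy) i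
  have e2 : ∀ i j, pd2 (fun y => φ (U y)) i j x =
      ψ (U x) * pd2 U i j x + θ (U x) * pd U i x * pd U j x := by
    intro i j
    rw [pd2_eq, ((e1 j).pd i).eq_of_nhds, pd,
      fderiv_fun_mul (c := fun y => ψ (U y)) ((hψ (U x)).differentiableAt.comp x (hUd x hx))
        ((hU.contDiffAt_pd hUopen hx j).differentiableAt (by norm_num))]
    have := pd_comp (hψ (U x)) (hUd x hx) i
    simp only [pd] at this
    simp only [add_apply, smul_apply, smul_eq_mul, this,
      pd2_eq, pd]
    ring
  simp only [Lop, aQuad, e2, (e1 _).eq_of_nhds, mul_add, Finset.sum_add_distrib, Finset.mul_sum]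
  rw [add_right_comm]
  congr 1
  · congr 1
    · exact Finset.sum_congr rfl fun i _ => Finset.sum_congr rfl fun j _ => by ring
    · exact Finset.sum_congr rfl fun i _ => by ring
  · exact Finset.sum_congr rfl fun i _ => Finset.sum_congr rfl fun j _ => by ring

theorem integral_comp_level_eq_zero {n : ℕ} {𝒰 : Set (Eucl n)} (hUopen : IsOpen 𝒰)
    {a : Eucl n → Matrix (Fin n) (Fin n) ℝ}
    (ha : ∀ i j, ContinuousOn (fun x => a x i j) 𝒰)
    {V : Eucl n → Fin n → ℝ} (hV : ContinuousOn V 𝒰)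
    {u : Eucl n → ℝ} (hu : ContinuousOn u 𝒰)
    (hu_stat : ∀ f : Eucl n → ℝ, ContDiff ℝ (⊤ : ℕ∞) f → HasCompactSupport f →
      tsupport f ⊆ 𝒰 → (∫ x in 𝒰, Lop a V f x * u x) = 0)
    {U : Eucl n → ℝ} (hU : ContDiffOn ℝ 2 U 𝒰) {β : ℝ} (hK : IsCompact {x ∈ 𝒰 | U x ≤ β})
    {φ ψ θ : ℝ → ℝ} (hφ : ∀ t, HasDerivAt φ (ψ t) t) (hψ : ∀ t, HasDerivAt ψ (θ t) t)
    (hθ : Continuous θ) (hφβ : ∀ t, β < t → φ t = 0) :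
    (∫ x in 𝒰, (ψ (U x) * Lop a V U x + θ (U x) * aQuad a U x) * u x) = 0 := by
  classical
  set K := {x ∈ 𝒰 | U x ≤ β} with hKdef
  let f : Eucl n → ℝ := fun x => if x ∈ 𝒰 then φ (U x) else 0
  have hf1 : ∀ x ∈ 𝒰, f =ᶠ[𝓝 x] fun y => φ (U y) := fun x hx =>
    (hUopen.eventually_mem hx).mono fun y hy => if_pos hy
  have hf0 : ∀ x ∉ K, f x = 0 := by
    intro x hx
    by_cases hxU : x ∈ 𝒰
    · have : β < U x := not_le.1 fun h => hx ⟨hxU, h⟩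
      simp [f, hxU, hφβ _ this]
    · simp [f, hxU]
  have hfK : tsupport f ⊆ K := closure_minimal
    (fun x hx => by_contra fun h => hx (hf0 x h)) hK.isClosed
  have hfC : ContDiff ℝ 2 f := by
    rw [contDiff_iff_contDiffAt]
    intro x
    by_cases hxU : x ∈ 𝒰
    · exact (((contDiff_two_of_hasDerivAt hφ hψ hθ).contDiffAt).comp x
        (hU.contDiffAt (hUopen.mem_nhds hxU))).congr_of_eventuallyEq (hf1 x hxU)
    · have : f =ᶠ[𝓝 x] fun _ => 0 :=
        (hK.isClosed.isOpen_compl.eventually_mem fun h => hxU h.1).mono hf0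
      exact contDiffAt_const.congr_of_eventuallyEq this
  rw [← integral_Lop_mul_eq_zero_of_contDiff_two hUopen ha hV hu hu_stat hfC
    (hK.of_isClosed_subset (isClosed_tsupport _) hfK) (hfK.trans fun x hx => hx.1)]
  refine setIntegral_congr_fun hUopen.measurableSet fun x hx => ?_
  exact congrArg (· * u x)
    ((Lop_congr a V (hf1 x hx)).trans (Lop_comp a V hUopen hU hφ hψ hx)).symm

/-! ### Integrals of functions of `U` over sublevel sets -/

theorem measurableSet_shell {X : Type*} [TopologicalSpace X] [MeasurableSpace X]
    [OpensMeasurableSpace X] {S : Set X} {U : X → ℝ} (hS : IsOpen S) (hU : ContinuousOn U S)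
    (α β : ℝ) :
    MeasurableSet {x ∈ S | α ≤ U x ∧ U x < β} := by
  have h : {x ∈ S | α ≤ U x ∧ U x < β} = (S ∩ U ⁻¹' Iio β) \ (S ∩ U ⁻¹' Iio α) := by
    ext x
    constructor
    · rintro ⟨h1, h2, h3⟩
      exact ⟨⟨h1, h3⟩, fun h => (not_lt.2 h2) h.2⟩
    · rintro ⟨⟨h1, h2⟩, h3⟩
      exact ⟨h1, not_lt.1 fun h => h3 ⟨h1, h⟩, h2⟩
  rw [h]
  exact (hU.isOpen_inter_preimage hS isOpen_Iio).measurableSet.diff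
    (hU.isOpen_inter_preimage hS isOpen_Iio).measurableSet

section Sublevel

variable {X : Type*} [TopologicalSpace X] [T2Space X] [MeasurableSpace X] [BorelSpace X]
  {μ : Measure X} [IsFiniteMeasureOnCompacts μ] {S : Set X} {U G : X → ℝ} {d : ℝ}

theorem integrableOn_comp_mul (hS : MeasurableSet S) (hU : ContinuousOn U S)
    (hG : ContinuousOn G S) (hK : IsCompact {x ∈ S | U x ≤ d}) {g : ℝ → ℝ} (hg : Continuous g)
    (hgd : ∀ t, d < t → g t = 0) : IntegrableOn (fun x => g (U x) * G x) S μ := by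
  have h : IntegrableOn (fun x => g (U x) * G x) {x ∈ S | U x ≤ d} μ :=
    (((hg.comp_continuousOn hU).mul hG).mono fun x hx => hx.1).integrableOn_compact hK
  refine h.of_forall_sdiff_eq_zero hS fun x hx => ?_
  rw [hgd _ (not_le.1 fun hle => hx.2 ⟨hx.1, hle⟩), zero_mul]

theorem tendsto_setIntegral_comp_mul (hS : MeasurableSet S) (hU : ContinuousOn U S)
    (hG : ContinuousOn G S) (hK : IsCompact {x ∈ S | U x ≤ d}) {g : ℕ → ℝ → ℝ} {g' : ℝ → ℝ}
    {C : ℝ} (hg : ∀ k, Continuous (g k)) (hgd : ∀ k t, d < t → g k t = 0)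
    (hC : ∀ k t, |g k t| ≤ C) (hlim : ∀ t, Tendsto (fun k => g k t) atTop (𝓝 (g' t))) :
    Tendsto (fun k => ∫ x in S, g k (U x) * G x ∂μ) atTop
      (𝓝 (∫ x in S, g' (U x) * G x ∂μ)) := by
  refine tendsto_integral_of_dominated_convergence
    ({x ∈ S | U x ≤ d}.indicator fun x => C * |G x|) ?_ ?_ ?_ ?_
  · exact fun k => (integrableOn_comp_mul hS hU hG hK (hg k) (hgd k)).1
  · have : IntegrableOn (fun x => C * |G x|) {x ∈ S | U x ≤ d} μ :=
      ((continuousOn_const.mul hG.abs).mono fun x hx => hx.1).integrableOn_compact hK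
    exact ((integrable_indicator_iff hK.measurableSet).2 this).integrableOn
  · refine fun k => (ae_restrict_mem hS).mono fun x hx => ?_
    by_cases hd : U x ≤ d
    · rw [indicator_of_mem (show x ∈ {x ∈ S | U x ≤ d} from ⟨hx, hd⟩), Real.norm_eq_abs, abs_mul]
      exact mul_le_mul_of_nonneg_right (hC _ _) (abs_nonneg _)
    · rw [indicator_of_notMem fun h => hd h.2, hgd k _ (not_le.1 hd), zero_mul, norm_zero]
  · exact Eventually.of_forall fun x => (hlim _).mul_const _

/-- If `U` satisfies the tested second-order identity below, with `D ≥ 0` where `U > ρm`, then the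
image under `U` of `W` has nondecreasing averages, up to an error for mass below `ρm`. -/
theorem comp_mul_integral_le (hS : MeasurableSet S) (hU : ContinuousOn U S)
    {W D : X → ℝ} (hW : ContinuousOn W S) (hD : ContinuousOn D S) {ρm b : ℝ}
    (hDpos : ∀ x ∈ S, ρm < U x → 0 ≤ D x)
    (hK : IsCompact {x ∈ S | U x ≤ d})
    (hKm : IsCompact {x ∈ S | U x ≤ ρm})
    (hid : ∀ φ ψ θ : ℝ → ℝ, (∀ t, HasDerivAt φ (ψ t) t) → (∀ t, HasDerivAt ψ (θ t) t) →
      Continuous θ → (∀ t, d < t → φ t = 0) →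
      (∫ x in S, (ψ (U x) * D x + θ (U x) * W x) ∂μ) = 0)
    {α C : ℝ} (hα : α ≤ ρm) (hb : ρm ≤ b) (hbd : b ≤ d) {f g : ℝ → ℝ}
    (hf : Continuous f) (hg : Continuous g) (hf0 : ∀ t, 0 ≤ f t) (hg0 : ∀ t, 0 ≤ g t)
    (hfα : ∀ t, t < α → f t = 0) (hfb : ∀ t, b < t → f t = 0) (hfC : ∀ t, f t ≤ C)
    (hgb : ∀ t, t < b → g t = 0) (hgd : ∀ t, d < t → g t = 0) :
    (∫ x in S, f (U x) * W x ∂μ) * (∫ t, g t) ≤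
      (∫ x in S, g (U x) * W x ∂μ) * (∫ t, f t) +
        (ρm - α) * C * (∫ t, g t) * ∫ x in {x ∈ S | U x ≤ ρm}, |D x| ∂μ := by
  have fi : Integrable f := hf.integrable_of_hasCompactSupport
    (HasCompactSupport.intro (isCompact_Icc (a := α) (b := b)) fun t ht => by
      rcases lt_or_ge t α with h | h
      · exact hfα t h
      · exact hfb t (not_le.1 fun h' => ht ⟨h, h'⟩))
  have gi : Integrable g := hg.integrable_of_hasCompactSupport
    (HasCompactSupport.intro (isCompact_Icc (a := b) (b := d)) fun t ht => by
      rcases lt_or_ge t b with h | h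
      · exact hgb t h
      · exact hgd t (not_le.1 fun h' => ht ⟨h, h'⟩))
  set I := ∫ t, f t with hI
  set J := ∫ t, g t with hJ
  have I0 : 0 ≤ I := integral_nonneg hf0
  have J0 : 0 ≤ J := integral_nonneg hg0
  let P : ℝ → ℝ := fun t => ∫ s in Iic t, f s
  let Q : ℝ → ℝ := fun t => ∫ s in Iic t, g s
  have hder : ∀ q : ℝ → ℝ, Continuous q → Integrable q → ∀ t,
      HasDerivAt (fun t => ∫ s in Iic t, q s) (q t) t := by
    intro q hq qi t
    have e : (fun t => ∫ s in Iic t, q s) = fun t => (∫ s in Iic 0, q s) + ∫ s in (0)..t, q s := by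
      funext t
      rw [← intervalIntegral.integral_Iic_sub_Iic qi.integrableOn qi.integrableOn]
      ring
    rw [e]
    exact (intervalIntegral.integral_hasDerivAt_right (hq.intervalIntegrable _ _)
      hq.aestronglyMeasurable.stronglyMeasurableAtFilter hq.continuousAt).const_add _
  have P0 : ∀ t, 0 ≤ P t := fun t => integral_nonneg hf0
  have PI : ∀ t, b ≤ t → P t = I := by
    intro t ht
    refine setIntegral_eq_integral_of_forall_compl_eq_zero fun s hs => ?_
    exact hfb s (ht.trans_lt (not_le.1 hs))
  have Q0 : ∀ t, t ≤ b → Q t = 0 := by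
    intro t ht
    change ∫ s in Iic t, g s = 0
    rw [integral_Iic_eq_integral_Iio]
    exact setIntegral_eq_zero_of_forall_eq_zero fun s hs => hgb s (lt_of_lt_of_le hs ht)
  have QJ : ∀ t, Q t ≤ J := fun t =>
    setIntegral_le_integral gi (Eventually.of_forall hg0)
  have QJ' : ∀ t, d ≤ t → Q t = J := by
    intro t ht
    refine setIntegral_eq_integral_of_forall_compl_eq_zero fun s hs => ?_
    exact hgd s (ht.trans_lt (not_le.1 hs))
  have PC : ∀ t, t ≤ ρm → P t ≤ (ρm - α) * C := by
    intro t ht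
    calc P t = ∫ s in Icc α t, f s := by
          refine setIntegral_eq_of_subset_of_forall_sdiff_eq_zero measurableSet_Iic
            (fun s hs => hs.2) fun s hs => ?_
          exact hfα s (not_le.1 fun h => hs.2 ⟨h, hs.1⟩)
      _ ≤ ∫ s in Icc α ρm, f s := setIntegral_mono_set fi.integrableOn
          (Eventually.of_forall hf0) (Icc_subset_Icc_right ht).eventuallyLE
      _ ≤ ∫ _ in Icc α ρm, C := setIntegral_mono fi.integrableOn
          (integrableOn_const (by simp)) hfC
      _ = (ρm - α) * C := by simp [hα]
  let θ : ℝ → ℝ := fun t => J * f t - I * g t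
  let ψ : ℝ → ℝ := fun t => J * P t - I * Q t
  let φ : ℝ → ℝ := fun t => ∫ s in d..t, ψ s
  have hψ : ∀ t, HasDerivAt ψ (θ t) t := fun t =>
    ((hder f hf fi t).const_mul J).sub ((hder g hg gi t).const_mul I)
  have ψc : Continuous ψ := continuous_iff_continuousAt.2 fun t => (hψ t).continuousAt
  have hφ : ∀ t, HasDerivAt φ (ψ t) t := fun t =>
    intervalIntegral.integral_hasDerivAt_right (ψc.intervalIntegrable _ _)
      ψc.aestronglyMeasurable.stronglyMeasurableAtFilter ψc.continuousAt
  have θc : Continuous θ := (continuous_const.mul hf).sub (continuous_const.mul hg)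
  have ψd : ∀ t, d ≤ t → ψ t = 0 := by
    intro t ht
    simp only [ψ, PI t (hbd.trans ht), QJ' t ht]
    ring
  have φd : ∀ t, d < t → φ t = 0 := by
    intro t ht
    refine intervalIntegral.integral_zero_ae (Eventually.of_forall fun s hs => ψd s ?_)
    rw [uIoc_of_le ht.le] at hs
    exact hs.1.le
  have ψ0 : ∀ t, 0 ≤ ψ t := by
    intro t
    rcases le_total t b with h | h
    · simp only [ψ, Q0 t h]
      have := mul_nonneg J0 (P0 t)
      linarith
    · simp only [ψ, PI t h]
      have := mul_le_mul_of_nonneg_left (QJ t) I0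
      linarith
  have hzero := hid φ ψ θ hφ hψ θc φd
  have iD : IntegrableOn (fun x => ψ (U x) * D x) S μ :=
    integrableOn_comp_mul hS hU hD hK ψc fun t ht => ψd t ht.le
  have if' : IntegrableOn (fun x => f (U x) * W x) S μ :=
    integrableOn_comp_mul hS hU hW hK hf fun t ht => hfb t (hbd.trans_lt ht)
  have ig' : IntegrableOn (fun x => g (U x) * W x) S μ :=
    integrableOn_comp_mul hS hU hW hK hg hgd
  have eW : (∫ x in S, θ (U x) * W x ∂μ) =
      J * (∫ x in S, f (U x) * W x ∂μ) - I * ∫ x in S, g (U x) * W x ∂μ := by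
    rw [← integral_const_mul, ← integral_const_mul,
      ← integral_sub (if'.const_mul J) (ig'.const_mul I)]
    refine integral_congr_ae (Eventually.of_forall fun x => ?_)
    simp only [θ]
    ring
  rw [integral_add iD (integrableOn_comp_mul hS hU hW hK θc fun t ht => by
    simp only [θ, hfb t (hbd.trans_lt ht), hgd t ht]; ring), eW] at hzero
  have hKmi : IntegrableOn (fun x => (ρm - α) * C * J * |D x|) {x ∈ S | U x ≤ ρm} μ :=
    ((continuousOn_const.mul hD.abs).mono fun x hx => hx.1).integrableOn_compact hKm
  have hDle : (∫ x in S, -(ψ (U x) * D x) ∂μ) ≤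
      (ρm - α) * C * J * ∫ x in {x ∈ S | U x ≤ ρm}, |D x| ∂μ := by
    rw [← integral_const_mul, ← integral_indicator hKm.measurableSet,
      ← integral_indicator hS]
    refine integral_mono ((integrable_indicator_iff hS).2 iD.neg)
      ((integrable_indicator_iff hKm.measurableSet).2 hKmi) fun x => ?_
    by_cases hx : x ∈ S
    · rw [indicator_of_mem hx]
      by_cases hm : U x ≤ ρm
      · rw [indicator_of_mem (show x ∈ {x ∈ S | U x ≤ ρm} from ⟨hx, hm⟩)]
        have h1 : ψ (U x) ≤ (ρm - α) * C * J := by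
          simp only [ψ, Q0 _ (hm.trans hb)]
          have := mul_le_mul_of_nonneg_left (PC _ hm) J0
          linarith
        calc -(ψ (U x) * D x) ≤ |ψ (U x) * D x| := neg_le_abs _
          _ = ψ (U x) * |D x| := by rw [abs_mul, abs_of_nonneg (ψ0 _)]
          _ ≤ _ := mul_le_mul_of_nonneg_right h1 (abs_nonneg _)
      · rw [indicator_of_notMem fun h => hm h.2]
        have := mul_nonneg (ψ0 (U x)) (hDpos x hx (not_le.1 hm))
        linarith
    · rw [indicator_of_notMem hx, indicator_of_notMem fun h => hx h.1]
  rw [integral_neg] at hDle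
  linarith

/-- A trapezoidal function increasing to `1` on `[α - 1 / (k + 1), α]` and decreasing to `0` at `β`,
converging to the indicator of `[α, β)`. -/
def ramp (α β : ℝ) (k : ℕ) (t : ℝ) : ℝ :=
  max 0 (min 1 (min (1 + (k + 1) * (t - α)) ((k + 1) * (β - t))))

theorem continuous_ramp (α β : ℝ) (k : ℕ) : Continuous (ramp α β k) := by
  unfold ramp
  fun_prop

theorem ramp_nonneg (α β : ℝ) (k : ℕ) (t : ℝ) : 0 ≤ ramp α β k t := le_max_left _ _

theorem ramp_le_one (α β : ℝ) (k : ℕ) (t : ℝ) : ramp α β k t ≤ 1 :=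
  max_le zero_le_one (min_le_left _ _)

theorem ramp_of_lt {α β : ℝ} {k : ℕ} {t : ℝ} (h : t < α - 1 / (k + 1)) : ramp α β k t = 0 := by
  refine max_eq_left ((min_le_right _ _).trans ((min_le_left _ _).trans ?_))
  have hk : (0 : ℝ) < k + 1 := by positivity
  have : (k + 1 : ℝ) * (t - α) ≤ (k + 1) * (-(1 / (k + 1))) :=
    mul_le_mul_of_nonneg_left (by linarith) hk.le
  have e : (k + 1 : ℝ) * (-(1 / (k + 1))) = -1 := by field_simp
  linarith

theorem ramp_of_ge {α β : ℝ} {k : ℕ} {t : ℝ} (h : β ≤ t) : ramp α β k t = 0 := by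
  refine max_eq_left ((min_le_right _ _).trans ((min_le_right _ _).trans ?_))
  exact mul_nonpos_of_nonneg_of_nonpos (by positivity) (by linarith)

theorem eventually_le_add_one_mul {ε : ℝ} (hε : 0 < ε) (c : ℝ) :
    ∀ᶠ k : ℕ in atTop, c ≤ (k + 1) * ε := by
  have : Tendsto (fun k : ℕ => ((k : ℝ) + 1) * ε) atTop atTop :=
    (tendsto_atTop_add_const_right _ _ tendsto_natCast_atTop_atTop).atTop_mul_const hε
  exact this.eventually_ge_atTop c

theorem tendsto_ramp (α β t : ℝ) :
    Tendsto (fun k => ramp α β k t) atTop (𝓝 ((Ico α β).indicator 1 t)) := by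
  refine tendsto_const_nhds.congr' ?_
  rcases lt_or_ge t α with h | h
  · rw [indicator_of_notMem fun h' => (not_le.2 h) h'.1]
    filter_upwards [eventually_le_add_one_mul (sub_pos.2 h) 1] with k hk
    refine (max_eq_left ((min_le_right _ _).trans ((min_le_left _ _).trans ?_))).symm
    linarith
  · rcases lt_or_ge t β with h2 | h2
    · rw [indicator_of_mem (show t ∈ Ico α β from ⟨h, h2⟩)]
      filter_upwards [eventually_le_add_one_mul (sub_pos.2 h2) 1] with k hk
      have h3 : (0 : ℝ) ≤ (k + 1) * (t - α) := mul_nonneg (by positivity) (by linarith)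
      rw [ramp, min_eq_left (le_min (by linarith) hk), max_eq_right zero_le_one]
      rfl
    · rw [indicator_of_notMem fun h' => (not_lt.2 h2) h'.2]
      exact Eventually.of_forall fun k => (ramp_of_ge h2).symm

theorem shell_mul_integral_le (hS : IsOpen S) (hU : ContinuousOn U S)
    {W D u : X → ℝ} (hW : ContinuousOn W S) (hD : ContinuousOn D S) (hu : ContinuousOn u S)
    {ρm b : ℝ} (hDpos : ∀ x ∈ S, ρm < U x → 0 ≤ D x)
    (hK : ∀ ρ ≤ d, IsCompact {x ∈ S | U x ≤ ρ})
    (hid : ∀ φ ψ θ : ℝ → ℝ, (∀ t, HasDerivAt φ (ψ t) t) → (∀ t, HasDerivAt ψ (θ t) t) →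
      Continuous θ → (∀ t, d < t → φ t = 0) →
      (∫ x in S, (ψ (U x) * D x + θ (U x) * W x) ∂μ) = 0)
    (hb : ρm < b) (hbd : b ≤ d) {h : ℝ → ℝ} (hh : ContinuousOn h (Icc ρm b))
    (hh0 : ∀ t ∈ Icc ρm b, 0 < h t)
    (huW : ∀ x ∈ S, ρm ≤ U x → U x < b → h (U x) * u x ≤ W x) {g : ℝ → ℝ}
    (hg : Continuous g) (hg0 : ∀ t, 0 ≤ g t)
    (hgb : ∀ t, t < b → g t = 0) (hgd : ∀ t, d < t → g t = 0) :
    (∫ x in {x ∈ S | ρm ≤ U x ∧ U x < b}, u x ∂μ) * (∫ t, g t) ≤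
      (∫ x in S, g (U x) * W x ∂μ) * ∫ t in ρm..b, 1 / h t := by
  have hKb := hK b hbd
  let q : ℝ → ℝ := fun t => 1 / h (projIcc ρm b hb.le t)
  have hqc : Continuous q := by
    refine continuous_const.div ?_ fun t => (hh0 _ (projIcc ρm b hb.le t).2).ne'
    exact (continuousOn_iff_continuous_domRestrict.1 hh).comp continuous_projIcc
  have hq : ∀ t ∈ Icc ρm b, q t = 1 / h t := fun t ht => by
    simp only [q, projIcc_of_mem hb.le ht]
  have hq0 : ∀ t, 0 ≤ q t := fun t => one_div_nonneg.2 (hh0 _ (projIcc ρm b hb.le t).2).le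
  obtain ⟨C, hC⟩ : ∃ C, ∀ t, q t ≤ C := by
    obtain ⟨C, hC⟩ := (isCompact_Icc (a := ρm) (b := b)).exists_bound_of_continuousOn
      hqc.continuousOn
    refine ⟨C, fun t => ?_⟩
    have h1 := hC _ (projIcc ρm b hb.le t).2
    have h2 : q (projIcc ρm b hb.le t) = q t := by simp only [q, projIcc_val]
    rw [h2] at h1
    exact (le_abs_self _).trans h1
  let f : ℕ → ℝ → ℝ := fun k t => ramp ρm b k t * q t
  let f' : ℝ → ℝ := fun t => (Ico ρm b).indicator 1 t * q t
  have hfc : ∀ k, Continuous (f k) := fun k => (continuous_ramp _ _ k).mul hqc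
  have hf0 : ∀ k t, 0 ≤ f k t := fun k t => mul_nonneg (ramp_nonneg _ _ _ _) (hq0 t)
  have hfC : ∀ k t, f k t ≤ C := fun k t =>
    (mul_le_of_le_one_left (hq0 t) (ramp_le_one _ _ _ _)).trans (hC t)
  have hfb : ∀ k t, b < t → f k t = 0 := fun k t ht => by simp only [f, ramp_of_ge ht.le, zero_mul]
  have hfα : ∀ (k : ℕ) (t : ℝ), t < ρm - 1 / ((k : ℝ) + 1) → f k t = 0 := fun k t ht => by
    simp only [f, ramp_of_lt ht, zero_mul]
  have hlim : ∀ t, Tendsto (fun k => f k t) atTop (𝓝 (f' t)) := fun t =>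
    (tendsto_ramp _ _ t).mul_const _
  set J := ∫ t, g t
  set M := ∫ x in {x ∈ S | U x ≤ ρm}, |D x| ∂μ
  have key : ∀ k : ℕ, (∫ x in S, f k (U x) * W x ∂μ) * J ≤
      (∫ x in S, g (U x) * W x ∂μ) * (∫ t, f k t) + 1 / ((k : ℝ) + 1) * (C * J * M) := by
    intro k
    have hk : (0 : ℝ) ≤ 1 / ((k : ℝ) + 1) := by positivity
    have := comp_mul_integral_le hS.measurableSet hU hW hD hDpos (hK d le_rfl)
      (hK ρm (hb.le.trans hbd)) hid (α := ρm - 1 / ((k : ℝ) + 1)) (by linarith) hb.le hbd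
      (hfc k) hg (hf0 k) hg0 (hfα k) (hfb k) (hfC k) hgb hgd
    refine this.trans (le_of_eq ?_)
    ring
  have l1 : Tendsto (fun k => ∫ x in S, f k (U x) * W x ∂μ) atTop
      (𝓝 (∫ x in S, f' (U x) * W x ∂μ)) :=
    tendsto_setIntegral_comp_mul hS.measurableSet hU hW hKb hfc hfb
      (fun k t => (abs_of_nonneg (hf0 k t)).trans_le (hfC k t)) hlim
  have l2 : Tendsto (fun k => ∫ t, f k t) atTop (𝓝 (∫ t, f' t)) := by
    refine tendsto_integral_of_dominated_convergence ((Icc (ρm - 1) b).indicator fun _ => C)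
      (fun k => (hfc k).aestronglyMeasurable)
      ((integrable_indicator_iff measurableSet_Icc).2 (integrableOn_const (by simp)))
      (fun k => Eventually.of_forall fun t => ?_) (Eventually.of_forall hlim)
    rw [Real.norm_eq_abs, abs_of_nonneg (hf0 k t)]
    by_cases ht : t ∈ Icc (ρm - 1) b
    · rw [indicator_of_mem ht]
      exact hfC k t
    · rw [indicator_of_notMem ht]
      rcases lt_or_ge t (ρm - 1) with h1 | h1
      · refine (hfα k t (h1.trans_le ?_)).le
        have : 1 / ((k : ℝ) + 1) ≤ 1 := by
          rw [div_le_one (by positivity)]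
          linarith [k.cast_nonneg (α := ℝ)]
        linarith
      · exact (hfb k t (not_le.1 fun h2 => ht ⟨h1, h2⟩)).le
  have l3 : Tendsto (fun k : ℕ => 1 / ((k : ℝ) + 1) * (C * J * M)) atTop (𝓝 0) := by
    simpa using (tendsto_one_div_add_atTop_nhds_zero_nat (𝕜 := ℝ)).mul_const (C * J * M)
  have lim := le_of_tendsto_of_tendsto' (l1.mul_const J) ((l2.const_mul _).add l3) key
  rw [add_zero] at lim
  have e2 : (∫ t, f' t) = ∫ t in ρm..b, 1 / h t := by
    rw [intervalIntegral.integral_of_le hb.le, ← integral_Ico_eq_integral_Ioc,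
      ← integral_indicator measurableSet_Ico]
    refine integral_congr_ae (Eventually.of_forall fun t => ?_)
    by_cases ht : t ∈ Ico ρm b
    · simp [f', ht, hq t ⟨ht.1, ht.2.le⟩]
    · simp [f', ht]
  have hE := measurableSet_shell hS hU ρm b
  have hEK : {x ∈ S | ρm ≤ U x ∧ U x < b} ⊆ {x ∈ S | U x ≤ b} := fun x hx => ⟨hx.1, hx.2.2.le⟩
  have e1 : (∫ x in {x ∈ S | ρm ≤ U x ∧ U x < b}, u x ∂μ) ≤ ∫ x in S, f' (U x) * W x ∂μ := by
    have e : (∫ x in S, f' (U x) * W x ∂μ) =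
        ∫ x in {x ∈ S | ρm ≤ U x ∧ U x < b}, q (U x) * W x ∂μ := by
      rw [setIntegral_eq_of_subset_of_forall_sdiff_eq_zero hS.measurableSet
        (show {x ∈ S | ρm ≤ U x ∧ U x < b} ⊆ S from fun x hx => hx.1)]
      · refine setIntegral_congr_fun hE fun x hx => ?_
        have : U x ∈ Ico ρm b := hx.2
        simp [f', this]
      · intro x hx
        have : U x ∉ Ico ρm b := fun h' => hx.2 ⟨hx.1, h'⟩
        simp [f', this]
    rw [e]
    refine setIntegral_mono_on (((hu.mono fun x hx => hx.1).integrableOn_compact hKb).mono_set hEK)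
      (((((hqc.comp_continuousOn hU).mul hW).mono fun x hx => hx.1).integrableOn_compact
        hKb).mono_set hEK) hE fun x hx => ?_
    have hx' : U x ∈ Icc ρm b := ⟨hx.2.1, hx.2.2.le⟩
    rw [hq _ hx', one_div, le_inv_mul_iff₀ (hh0 _ hx')]
    exact huW x hx.1 hx.2.1 hx.2.2
  rw [← e2]
  exact (mul_le_mul_of_nonneg_right e1 (integral_nonneg hg0)).trans lim

theorem shell_mul_volume_le (hS : IsOpen S) (hU : ContinuousOn U S)
    {W : X → ℝ} (hW : ContinuousOn W S) (hW0 : ∀ x ∈ S, 0 ≤ W x)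
    (hK : IsCompact {x ∈ S | U x ≤ d}) {b m Φ : ℝ}
    (key : ∀ g : ℝ → ℝ, Continuous g → (∀ t, 0 ≤ g t) →
      (∀ t, t < b → g t = 0) → (∀ t, d < t → g t = 0) →
      m * (∫ t, g t) ≤ (∫ x in S, g (U x) * W x ∂μ) * Φ)
    (hΦ : 0 < Φ) {F : Set ℝ} (hF : IsCompact F) (hFbd : F ⊆ Ioo b d) :
    ENNReal.ofReal (m / Φ) * volume F ≤ ∫⁻ x in S ∩ U ⁻¹' F, ENNReal.ofReal (W x) ∂μ := by
  rcases F.eq_empty_or_nonempty with rfl | hne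
  · simp
  let g : ℕ → ℝ → ℝ := fun k t => max 0 (1 - (k + 1) * Metric.infDist t F) *
    max 0 (min 1 (min ((k + 1) * (t - b)) ((k + 1) * (d - t))))
  have hgc : ∀ k, Continuous (g k) := fun k => by
    have := Metric.continuous_infDist_pt F
    fun_prop
  have hg0 : ∀ k t, 0 ≤ g k t := fun k t => mul_nonneg (le_max_left _ _) (le_max_left _ _)
  have hg1 : ∀ k t, g k t ≤ 1 := fun k t => by
    refine mul_le_one₀ (max_le zero_le_one ?_) (le_max_left _ _)
      (max_le zero_le_one (min_le_left _ _))
    have : 0 ≤ ((k : ℝ) + 1) * Metric.infDist t F := mul_nonneg (by positivity) Metric.infDist_nonneg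
    linarith
  have hgb : ∀ k t, t ≤ b → g k t = 0 := fun k t ht => by
    have : max 0 (min 1 (min (((k : ℝ) + 1) * (t - b)) ((k + 1) * (d - t)))) = 0 :=
      max_eq_left ((min_le_right _ _).trans ((min_le_left _ _).trans
        (mul_nonpos_of_nonneg_of_nonpos (by positivity) (by linarith))))
    simp only [g, this, mul_zero]
  have hgd : ∀ k t, d ≤ t → g k t = 0 := fun k t ht => by
    have : max 0 (min 1 (min (((k : ℝ) + 1) * (t - b)) ((k + 1) * (d - t)))) = 0 :=
      max_eq_left ((min_le_right _ _).trans ((min_le_right _ _).trans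
        (mul_nonpos_of_nonneg_of_nonpos (by positivity) (by linarith))))
    simp only [g, this, mul_zero]
  have hlim : ∀ t, Tendsto (fun k => g k t) atTop (𝓝 (F.indicator 1 t)) := by
    intro t
    refine tendsto_const_nhds.congr' ?_
    by_cases ht : t ∈ F
    · filter_upwards [eventually_le_add_one_mul (sub_pos.2 (hFbd ht).1) 1,
        eventually_le_add_one_mul (sub_pos.2 (hFbd ht).2) 1] with k h1 h2
      simp [g, ht, Metric.infDist_zero_of_mem ht, h1, h2]
    · filter_upwards [eventually_le_add_one_mul
        ((hF.isClosed.notMem_iff_infDist_pos hne).1 ht) 1] with k hk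
      simp [g, ht, max_eq_left (show 1 - ((k : ℝ) + 1) * Metric.infDist t F ≤ 0 by linarith)]
  have l1 : Tendsto (fun k => ∫ x in S, g k (U x) * W x ∂μ) atTop
      (𝓝 (∫ x in S, F.indicator 1 (U x) * W x ∂μ)) :=
    tendsto_setIntegral_comp_mul hS.measurableSet hU hW hK hgc (fun k t ht => hgd k t ht.le)
      (fun k t => (abs_of_nonneg (hg0 k t)).trans_le (hg1 k t)) hlim
  have l2 : Tendsto (fun k => ∫ t, g k t) atTop (𝓝 (∫ t, F.indicator 1 t)) := by
    refine tendsto_integral_of_dominated_convergence ((Icc b d).indicator fun _ => 1)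
      (fun k => (hgc k).aestronglyMeasurable)
      ((integrable_indicator_iff measurableSet_Icc).2 (integrableOn_const (by simp)))
      (fun k => Eventually.of_forall fun t => ?_) (Eventually.of_forall hlim)
    rw [Real.norm_eq_abs, abs_of_nonneg (hg0 k t)]
    by_cases ht : t ∈ Icc b d
    · rw [indicator_of_mem ht]
      exact hg1 k t
    · rw [indicator_of_notMem ht]
      rcases lt_or_ge t b with h1 | h1
      · exact (hgb k t h1.le).le
      · exact (hgd k t (not_le.1 fun h2 => ht ⟨h1, h2⟩).le).le
  have lim := le_of_tendsto_of_tendsto' (l2.const_mul m) (l1.mul_const Φ) fun k =>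
    key (g k) (hgc k) (hg0 k) (fun t ht => hgb k t ht.le) (fun t ht => hgd k t ht.le)
  have e2 : (∫ t, F.indicator (1 : ℝ → ℝ) t) = volume.real F := by
    rw [integral_indicator_one hF.measurableSet]
  have hFS : MeasurableSet (S ∩ U ⁻¹' F) := by
    obtain ⟨O, hO, hO'⟩ := continuousOn_iff_isClosed.1 hU F hF.isClosed
    rw [inter_comm, hO', inter_comm]
    exact hS.measurableSet.inter hO.measurableSet
  have hFK : S ∩ U ⁻¹' F ⊆ {x ∈ S | U x ≤ d} := fun x hx => ⟨hx.1, (hFbd hx.2).2.le⟩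
  have e1 : (∫ x in S, F.indicator 1 (U x) * W x ∂μ) = ∫ x in S ∩ U ⁻¹' F, W x ∂μ := by
    rw [setIntegral_eq_of_subset_of_forall_sdiff_eq_zero hS.measurableSet
        (show S ∩ U ⁻¹' F ⊆ S from fun x hx => hx.1)]
    · refine setIntegral_congr_fun hFS fun x hx => ?_
      have : U x ∈ F := hx.2
      simp [this]
    · intro x hx
      have : U x ∉ F := fun h' => hx.2 ⟨hx.1, h'⟩
      simp [this]
  rw [e1, e2] at lim
  have hWi : IntegrableOn W (S ∩ U ⁻¹' F) μ :=
    ((hW.mono fun x hx => hx.1).integrableOn_compact hK).mono_set hFK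
  rw [← ofReal_integral_eq_lintegral_ofReal hWi
    ((ae_restrict_mem hFS).mono fun x hx => hW0 x hx.1), ← ofReal_measureReal hF.measure_ne_top,
    ← ENNReal.ofReal_mul' measureReal_nonneg]
  refine ENNReal.ofReal_le_ofReal ?_
  rw [div_mul_eq_mul_div, div_le_iff₀ hΦ]
  exact lim

end Sublevel

/-! ### Comparison of measures and a multiplicative Grönwall inequality -/

theorem mul_lintegral_inv_le_of_compact {X : Type*} [MeasurableSpace X] {μ : Measure X}
    {T : X → ℝ} (hT : Measurable T) {w v : X → ENNReal} (hw : Measurable w)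
    {O : Set ℝ} (hO : MeasurableSet O) {c : ENNReal}
    (hF : ∀ F ⊆ O, IsCompact F → c * volume F ≤ ∫⁻ x in T ⁻¹' F, w x ∂μ)
    {H : ℝ → ENNReal} (hH : Measurable H) (hH0 : ∀ t ∈ O, H t ≠ 0) (hH1 : ∀ t ∈ O, H t ≠ ⊤)
    (hwv : ∀ x, T x ∈ O → w x ≤ H (T x) * v x) :
    c * ∫⁻ t in O, (H t)⁻¹ ≤ ∫⁻ x in T ⁻¹' O, v x ∂μ := by
  set ν := (μ.withDensity w).map T with hν
  have hνe : ∀ B, MeasurableSet B → ν B = ∫⁻ x in T ⁻¹' B, w x ∂μ := fun B hB => by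
    rw [hν, Measure.map_apply hT hB, withDensity_apply _ (hT hB)]
  have hle : c • (volume.restrict O) ≤ ν.restrict O := by
    refine Measure.le_iff.2 fun B hB => ?_
    rw [Measure.smul_apply, smul_eq_mul, Measure.restrict_apply hB, Measure.restrict_apply hB,
      (hB.inter hO).measure_eq_iSup_isCompact]
    simp only [ENNReal.mul_iSup]
    refine iSup_le fun F => iSup_le fun hFB => iSup_le fun hFc => ?_
    calc c * volume F ≤ ν F := by
          rw [hνe F hFc.measurableSet]
          exact hF F (hFB.trans inter_subset_right) hFc
      _ ≤ ν (B ∩ O) := measure_mono hFB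
  calc c * ∫⁻ t in O, (H t)⁻¹ = ∫⁻ t, (H t)⁻¹ ∂(c • (volume.restrict O)) := by
        rw [lintegral_smul_measure, smul_eq_mul]
    _ ≤ ∫⁻ t in O, (H t)⁻¹ ∂ν := lintegral_mono' hle le_rfl
    _ = ∫⁻ x in T ⁻¹' O, (H (T x))⁻¹ ∂(μ.withDensity w) :=
        setLIntegral_map hO hH.inv hT
    _ = ∫⁻ x in T ⁻¹' O, w x * (H (T x))⁻¹ ∂μ := by
        rw [restrict_withDensity (hT hO)]
        exact lintegral_withDensity_eq_lintegral_mul _ hw (g := fun x => (H (T x))⁻¹)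
          (hH.comp hT).inv
    _ ≤ ∫⁻ x in T ⁻¹' O, v x ∂μ := by
        refine setLIntegral_mono' (hT hO) fun x hx => ?_
        calc w x * (H (T x))⁻¹ ≤ H (T x) * v x * (H (T x))⁻¹ :=
              mul_le_mul_left (hwv x hx) _
          _ = v x * (H (T x) * (H (T x))⁻¹) := by ring
          _ = v x := by rw [ENNReal.mul_inv_cancel (hH0 _ hx) (hH1 _ hx), mul_one]

theorem mul_exp_integral_le {m f : ℝ → ℝ} {a b : ℝ} (hab : a ≤ b)
    (hf : IntervalIntegrable f volume a b) (hf0 : ∀ t ∈ Icc a b, 0 ≤ f t)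
    (hm0 : 0 ≤ m a)
    (hm : ∀ s t, a ≤ s → s ≤ t → t ≤ b → m s * (1 + ∫ r in s..t, f r) ≤ m t) :
    m a * Real.exp (∫ r in a..b, f r) ≤ m b := by
  set L := ∫ r in a..b, f r with hL
  let F : ℝ → ℝ := fun t => ∫ r in a..t, f r
  have hFc : ContinuousOn F (Icc a b) := by
    rw [← uIcc_of_le hab] at *
    exact intervalIntegral.continuousOn_primitive_interval' hf left_mem_uIcc
  have hi : ∀ s t, a ≤ s → s ≤ t → t ≤ b → IntervalIntegrable f volume s t := fun s t h1 h2 h3 =>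
    hf.mono_set (by rw [uIcc_of_le h2, uIcc_of_le hab]; exact Icc_subset_Icc h1 h3)
  have hpos : ∀ s t, a ≤ s → s ≤ t → t ≤ b → 0 ≤ ∫ r in s..t, f r := fun s t h1 h2 h3 =>
    intervalIntegral.integral_nonneg h2 fun r hr => hf0 r ⟨h1.trans hr.1, hr.2.trans h3⟩
  have hF : ∀ s t, a ≤ s → s ≤ t → t ≤ b → F t - F s = ∫ r in s..t, f r := fun s t h1 h2 h3 =>
    intervalIntegral.integral_interval_sub_left (hi a t le_rfl (h1.trans h2) h3)
      (hi a s le_rfl h1 (h2.trans h3))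
  have L0 : 0 ≤ L := hpos a b le_rfl hab le_rfl
  have hmono : ∀ t, a ≤ t → t ≤ b → 0 ≤ m t := by
    intro t h1 h2
    refine le_trans ?_ (hm a t le_rfl h1 h2)
    have := hpos a t le_rfl h1 h2
    positivity
  have key : ∀ N : ℕ, m a * (1 + L / N) ^ N ≤ m b := by
    intro N
    rcases Nat.eq_zero_or_pos N with rfl | hN
    · have := hm a b le_rfl hab le_rfl
      have h2 : m a ≤ m a * (1 + L) := le_mul_of_one_le_right hm0 (by linarith)
      simpa using h2.trans this
    have hN' : (0 : ℝ) < N := by exact_mod_cast hN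
    have hs : ∀ i : ℕ, i ≤ N → ∃ t ∈ Icc a b, F t = i * (L / N) := by
      intro i hi'
      refine intermediate_value_Icc hab hFc ⟨?_, ?_⟩
      · simp only [F, intervalIntegral.integral_same]
        positivity
      · change (i : ℝ) * (L / N) ≤ L
        have : (i : ℝ) ≤ N := by exact_mod_cast hi'
        calc (i : ℝ) * (L / N) ≤ N * (L / N) := by gcongr
          _ = L := by field_simp
    have hind : ∀ i : ℕ, i ≤ N → ∀ t ∈ Icc a b, F t = i * (L / N) →
        m a * (1 + L / N) ^ i ≤ m t := by
      intro i
      induction i with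
      | zero =>
        intro _ t ht _
        have h1 := hm a t le_rfl ht.1 ht.2
        have h2 := hpos a t le_rfl ht.1 ht.2
        rw [pow_zero]
        exact (mul_le_mul_of_nonneg_left (by linarith) hm0).trans h1
      | succ i ih =>
        intro hi' t ht hFt
        obtain ⟨s, hs1, hs2⟩ := hs i (by omega)
        have LN : 0 ≤ L / N := by positivity
        push_cast at hFt
        have hst : s ≤ t ∨ L / N = 0 := by
          rcases le_or_gt s t with h | h
          · exact Or.inl h
          · right
            have := hF t s ht.1 h.le hs1.2
            have := hpos t s ht.1 h.le hs1.2
            nlinarith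
        rcases hst with hst | h0
        · have h1 := hm s t hs1.1 hst ht.2
          rw [← hF s t hs1.1 hst ht.2, hFt, hs2] at h1
          have h2 := ih (by omega) s hs1 hs2
          calc m a * (1 + L / N) ^ (i + 1) = m a * (1 + L / N) ^ i * (1 + L / N) := by ring
            _ ≤ m s * (1 + L / N) := by gcongr
            _ = m s * (1 + ((i + 1) * (L / N) - i * (L / N))) := by ring
            _ ≤ m t := h1
        · have h2 := ih (by omega) t ht (by rw [hFt, h0]; ring)
          rw [h0] at h2 ⊢
          simpa using h2
    obtain ⟨t, ht, hFt⟩ := hs N le_rfl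
    have h1 := hind N le_rfl t ht hFt
    have h2 := hm t b ht.1 ht.2 le_rfl
    have h3 := hpos t b ht.1 ht.2 le_rfl
    have h4 := hmono t ht.1 ht.2
    exact h1.trans ((le_mul_of_one_le_right h4 (by linarith)).trans h2)
  exact le_of_tendsto' ((Real.tendsto_one_add_div_pow_exp L).const_mul (m a)) key

theorem ofReal_mul_lintegral_inv_le {X : Type*} [TopologicalSpace X] [T2Space X]
    [MeasurableSpace X] [BorelSpace X] {μ : Measure X} [IsFiniteMeasureOnCompacts μ]
    {S : Set X} {U W u : X → ℝ} {b d m Φ : ℝ} (hS : IsOpen S) (hU : ContinuousOn U S)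
    (hW : ContinuousOn W S) (hW0 : ∀ x ∈ S, 0 ≤ W x) (hu : ContinuousOn u S)
    (hu0 : ∀ x ∈ S, 0 ≤ u x) (hK : IsCompact {x ∈ S | U x ≤ d})
    (key : ∀ g : ℝ → ℝ, Continuous g → (∀ t, 0 ≤ g t) →
      (∀ t, t < b → g t = 0) → (∀ t, d < t → g t = 0) →
      m * (∫ t, g t) ≤ (∫ x in S, g (U x) * W x ∂μ) * Φ)
    (hΦ : 0 < Φ) {H : ℝ → ℝ} (hH : Measurable H) (hH0 : ∀ t ∈ Ioo b d, 0 < H t)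
    (hWu : ∀ x ∈ S, W x ≤ H (U x) * u x) :
    ENNReal.ofReal (m / Φ) * ∫⁻ t in Ioo b d, (ENNReal.ofReal (H t))⁻¹ ≤
      ENNReal.ofReal (∫ x in {x ∈ S | b ≤ U x ∧ U x < d}, u x ∂μ) := by
  classical
  set A := S ∩ U ⁻¹' Ioo b d with hA
  have hAo : IsOpen A := hU.isOpen_inter_preimage hS isOpen_Ioo
  have hAS : A ⊆ S := inter_subset_left
  have hpw : ∀ (g : X → ℝ) (c : ℝ), ContinuousOn g S → Measurable (A.piecewise g fun _ => c) :=
    fun g c hg => (hg.mono hAS).measurable_piecewise continuousOn_const hAo.measurableSet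
  set T := A.piecewise U fun _ => b with hT
  have hTA : ∀ x ∈ A, T x = U x := fun x hx => piecewise_eq_of_mem _ _ _ hx
  have hTO : ∀ x, T x ∈ Ioo b d ↔ x ∈ A := by
    intro x
    by_cases hx : x ∈ A
    · simp only [hTA x hx, hx, iff_true]
      exact hx.2
    · simp [hT, hx]
  have hpre : ∀ F ⊆ Ioo b d, T ⁻¹' F = S ∩ U ⁻¹' F := by
    intro F hF
    ext x
    constructor
    · intro hx
      have hxA := (hTO x).1 (hF hx)
      exact ⟨hxA.1, by rw [mem_preimage, ← hTA x hxA]; exact hx⟩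
    · intro hx
      have hxA : x ∈ A := ⟨hx.1, hF hx.2⟩
      rw [mem_preimage, hTA x hxA]
      exact hx.2
  have main := mul_lintegral_inv_le_of_compact (μ := μ) (T := T) (hpw U b hU)
    (w := fun x => ENNReal.ofReal (A.piecewise W (fun _ => 0) x))
    (v := fun x => ENNReal.ofReal (A.piecewise u (fun _ => 0) x))
    (hpw W 0 hW).ennreal_ofReal measurableSet_Ioo (c := ENNReal.ofReal (m / Φ))
    (H := fun t => ENNReal.ofReal (H t)) ?_ hH.ennreal_ofReal
    (fun t ht => (ENNReal.ofReal_pos.2 (hH0 t ht)).ne') (fun _ _ => ENNReal.ofReal_ne_top) ?_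
  · refine main.trans ?_
    have hE := measurableSet_shell hS hU b d
    have hAE : A ⊆ {x ∈ S | b ≤ U x ∧ U x < d} := fun x hx => ⟨hx.1, hx.2.1.le, hx.2.2⟩
    have hui : IntegrableOn u {x ∈ S | b ≤ U x ∧ U x < d} μ :=
      ((hu.mono fun x hx => hx.1).integrableOn_compact hK).mono_set
        fun x hx => ⟨hx.1, hx.2.2.le⟩
    rw [hpre _ Subset.rfl, ← hA, ofReal_integral_eq_lintegral_ofReal hui
      ((ae_restrict_mem hE).mono fun x hx => hu0 x hx.1)]
    calc ∫⁻ x in A, ENNReal.ofReal (A.piecewise u (fun _ => 0) x) ∂μ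
        = ∫⁻ x in A, ENNReal.ofReal (u x) ∂μ := by
          refine setLIntegral_congr_fun hAo.measurableSet fun x hx => ?_
          simp only [piecewise_eq_of_mem _ _ _ hx]
      _ ≤ _ := lintegral_mono_set hAE
  · intro F hFO hF
    refine (shell_mul_volume_le hS hU hW hW0 hK key hΦ hF hFO).trans (le_of_eq ?_)
    rw [hpre F hFO]
    refine (setLIntegral_congr_fun ?_ fun x hx => ?_).symm
    · rw [← hpre F hFO]
      exact (hpw U b hU) hF.measurableSet
    · have hxA : x ∈ A := ⟨hx.1, hFO hx.2⟩
      simp only [piecewise_eq_of_mem _ _ _ hxA]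
  · intro x hx
    have hxA := (hTO x).1 hx
    simp only [piecewise_eq_of_mem _ _ _ hxA, hTA x hxA]
    rw [← ENNReal.ofReal_mul (hH0 _ hxA.2).le]
    exact ENNReal.ofReal_le_ofReal (hWu x hxA.1)

theorem ContDiffOn.continuousOn_pd {n : ℕ} {𝒰 : Set (Eucl n)} (hUopen : IsOpen 𝒰)
    {U : Eucl n → ℝ} (hU : ContDiffOn ℝ 2 U 𝒰) (i : Fin n) : ContinuousOn (_root_.pd U i) 𝒰 :=
  fun _ hx => (hU.contDiffAt_pd hUopen hx i).continuousAt.continuousWithinAt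

theorem ContDiffOn.continuousOn_pd2 {n : ℕ} {𝒰 : Set (Eucl n)} (hUopen : IsOpen 𝒰)
    {U : Eucl n → ℝ} (hU : ContDiffOn ℝ 2 U 𝒰) (i j : Fin n) : ContinuousOn (pd2 U i j) 𝒰 :=
  fun _ hx => (((hU.contDiffAt_pd hUopen hx j).fderiv_right (m := 0) (by norm_num)).clm_apply
    contDiffAt_const).continuousAt.continuousWithinAt

/-- **Theorem B(b)**. -/
theorem thmB_b
    {n : ℕ} (hn : 0 < n)
    (𝒰 : Set (Eucl n)) (hUopen : IsOpen 𝒰) (hUconn : IsConnected 𝒰)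
    (a : Eucl n → Matrix (Fin n) (Fin n) ℝ)
    (ha_C1 : ∀ i j, ContDiffOn ℝ 1 (fun x => a x i j) 𝒰)
    (ha_symm : ∀ x ∈ 𝒰, ∀ i j, a x i j = a x j i)
    (ha_psd : ∀ x ∈ 𝒰, ∀ v : Fin n → ℝ, 0 ≤ ∑ i, ∑ j, a x i j * v i * v j)
    (V : Eucl n → Fin n → ℝ) (hV_cont : ContinuousOn V 𝒰)
    (u : Eucl n → ℝ) (hu_C1 : ContDiffOn ℝ 1 u 𝒰) (hu_nonneg : ∀ x ∈ 𝒰, 0 ≤ u x)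
    (hu_mass : (∫ x in 𝒰, u x) = 1)
    (hu_stat : ∀ f : Eucl n → ℝ, ContDiff ℝ (⊤ : ℕ∞) f → HasCompactSupport f →
      tsupport f ⊆ 𝒰 → (∫ x in 𝒰, Lop a V f x * u x) = 0)
    (U : Eucl n → ℝ) (ρM : EReal) (hU_C2 : ContDiffOn ℝ 2 U 𝒰)
    (hU_nonneg : ∀ x ∈ 𝒰, 0 ≤ U x)
    (hU_lt : ∀ x ∈ 𝒰, (U x : EReal) < ρM)
    (hU_sup : ρM = ⨆ x : 𝒰, (U x.1 : EReal))
    (hU_cpt : ∀ ρ : ℝ, (ρ : EReal) < ρM → IsCompact {x ∈ 𝒰 | U x ≤ ρ})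
    (ρm : ℝ) (hρm_pos : 0 < ρm) (hρm_lt : (ρm : EReal) < ρM)
    (hWAnti : ∀ x ∈ 𝒰, x ∉ closure {y ∈ 𝒰 | U y < ρm} → 0 ≤ Lop a V U x)
    (h : ℝ → ℝ) (hh_meas : Measurable h)
    (hh_nonneg : ∀ t : ℝ, 0 ≤ t → (t : EReal) < ρM → 0 ≤ h t)
    (hh_locbdd : ∀ ρ : ℝ, (ρ : EReal) < ρM → BddAbove (h '' Set.Icc 0 ρ))
    (hh_low : ∀ x ∈ 𝒰, h (U x) ≤ aQuad a U x)
    (H : ℝ → ℝ) (hH_meas : Measurable H)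
    (hH_nonneg : ∀ t : ℝ, 0 ≤ t → (t : EReal) < ρM → 0 ≤ H t)
    (hH_locbdd : ∀ ρ : ℝ, (ρ : EReal) < ρM → BddAbove (H '' Set.Icc 0 ρ))
    (hH_up : ∀ x ∈ 𝒰, aQuad a U x ≤ H (U x))
    (hh_pos : ∀ t : ℝ, ρm ≤ t → (t : EReal) < ρM → 0 < h t)
    (hh_cont : ContinuousOn h {t : ℝ | ρm ≤ t ∧ (t : EReal) < ρM})
    (hH_pos : ∀ t : ℝ, ρm < t → (t : EReal) < ρM → 0 < H t) :
    ∀ ρ0 ρ : ℝ, ρm < ρ0 → ρ0 ≤ ρ → (ρ : EReal) < ρM →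
      (∫ x in {x ∈ 𝒰 | ρm ≤ U x ∧ U x < ρ0}, u x) *
          Real.exp (∫ t in ρ0..ρ, 1 / (H t * ∫ s in ρm..t, 1 / h s)) ≤
        ∫ x in {x ∈ 𝒰 | ρm ≤ U x ∧ U x < ρ}, u x := by
  have hUc : ContinuousOn U 𝒰 := hU_C2.continuousOn
  have huc : ContinuousOn u 𝒰 := hu_C1.continuousOn
  have hac : ∀ i j, ContinuousOn (fun x => a x i j) 𝒰 := fun i j => (ha_C1 i j).continuousOn
  have hpd := hU_C2.continuousOn_pd hUopen
  have hLc : ContinuousOn (Lop a V U) 𝒰 :=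
    ContinuousOn.Lop hac hV_cont hpd (hU_C2.continuousOn_pd2 hUopen)
  have hQc : ContinuousOn (aQuad a U) 𝒰 :=
    continuousOn_finsetSum _ fun i _ => continuousOn_finsetSum _ fun j _ =>
      ((hac i j).mul (hpd i)).mul (hpd j)
  let D : Eucl n → ℝ := fun x => Lop a V U x * u x
  let W : Eucl n → ℝ := fun x => aQuad a U x * u x
  have hDc : ContinuousOn D 𝒰 := hLc.mul huc
  have hWc : ContinuousOn W 𝒰 := hQc.mul huc
  have hW0 : ∀ x ∈ 𝒰, 0 ≤ W x := fun x hx =>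
    mul_nonneg (ha_psd x hx fun i => pd U i x) (hu_nonneg x hx)
  have hD0 : ∀ x ∈ 𝒰, ρm < U x → 0 ≤ D x := by
    intro x hx hlt
    refine mul_nonneg (hWAnti x hx fun hcl => ?_) (hu_nonneg x hx)
    have hopen : IsOpen (𝒰 ∩ U ⁻¹' Ioi ρm) := hUc.isOpen_inter_preimage hUopen isOpen_Ioi
    obtain ⟨y, hy1, hy2⟩ := mem_closure_iff.1 hcl _ hopen ⟨hx, hlt⟩
    exact lt_asymm hy1.2 hy2.2
  let m : ℝ → ℝ := fun t => ∫ x in {x ∈ 𝒰 | ρm ≤ U x ∧ U x < t}, u x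
  let Φ : ℝ → ℝ := fun t => ∫ s in ρm..t, 1 / h s
  have hm0 : ∀ t, 0 ≤ m t := fun t =>
    setIntegral_nonneg (measurableSet_shell hUopen hUc _ _) fun x hx => hu_nonneg x hx.1
  have lt_top : ∀ {s t : ℝ}, s ≤ t → (t : EReal) < ρM → (s : EReal) < ρM := fun h1 h2 =>
    (EReal.coe_le_coe_iff.2 h1).trans_lt h2
  have hhi : ∀ s t : ℝ, ρm ≤ s → s ≤ t → (t : EReal) < ρM →
      IntervalIntegrable (fun r => 1 / h r) volume s t := by
    intro s t hs hst ht
    refine ContinuousOn.intervalIntegrable ?_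
    rw [uIcc_of_le hst]
    exact continuousOn_const.div
      (hh_cont.mono fun r hr => ⟨hs.trans hr.1, lt_top hr.2 ht⟩)
      fun r hr => (hh_pos r (hs.trans hr.1) (lt_top hr.2 ht)).ne'
  have hΦpos : ∀ t : ℝ, ρm < t → (t : EReal) < ρM → 0 < Φ t := by
    intro t hlt ht
    refine intervalIntegral.intervalIntegral_pos_of_pos_on (hhi ρm t le_rfl hlt.le ht) ?_ hlt
    exact fun r hr => one_div_pos.2 (hh_pos r hr.1.le (lt_top hr.2.le ht))
  have hΦmono : ∀ s t : ℝ, ρm ≤ s → s ≤ t → (t : EReal) < ρM → Φ s ≤ Φ t := by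
    intro s t hs hst ht
    have h1 := intervalIntegral.integral_add_adjacent_intervals
      (hhi ρm s le_rfl hs (lt_top hst ht)) (hhi s t hs hst ht)
    have h2 : 0 ≤ ∫ r in s..t, 1 / h r := intervalIntegral.integral_nonneg hst fun r hr =>
      (one_div_pos.2 (hh_pos r (hs.trans hr.1) (lt_top hr.2 ht))).le
    simp only [Φ]
    linarith
  have hsplit : ∀ s t : ℝ, ρm ≤ s → s ≤ t → (t : EReal) < ρM →
      m t = m s + ∫ x in {x ∈ 𝒰 | s ≤ U x ∧ U x < t}, u x := by
    intro s t hs hst ht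
    have hui : ∀ S' ⊆ {x ∈ 𝒰 | U x ≤ t}, IntegrableOn u S' := fun S' hS' =>
      ((huc.mono fun x hx => hx.1).integrableOn_compact (hU_cpt t ht)).mono_set hS'
    have hun : {x ∈ 𝒰 | ρm ≤ U x ∧ U x < t} =
        {x ∈ 𝒰 | ρm ≤ U x ∧ U x < s} ∪ {x ∈ 𝒰 | s ≤ U x ∧ U x < t} := by
      ext x
      constructor
      · rintro ⟨h1, h2, h3⟩
        rcases lt_or_ge (U x) s with h4 | h4
        · exact Or.inl ⟨h1, h2, h4⟩
        · exact Or.inr ⟨h1, h4, h3⟩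
      · rintro (⟨h1, h2, h3⟩ | ⟨h1, h2, h3⟩)
        · exact ⟨h1, h2, h3.trans_le hst⟩
        · exact ⟨h1, hs.trans h2, h3⟩
    simp only [m]
    rw [hun]
    exact setIntegral_union (Set.disjoint_left.2 fun x h1 h2 => not_lt.2 h2.2.1 h1.2.2)
      (measurableSet_shell hUopen hUc s t)
      (hui _ fun x hx => ⟨hx.1, hx.2.2.le.trans hst⟩) (hui _ fun x hx => ⟨hx.1, hx.2.2.le⟩)
  have hsh0 : ∀ s t : ℝ, 0 ≤ ∫ x in {x ∈ 𝒰 | s ≤ U x ∧ U x < t}, u x := fun s t =>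
    setIntegral_nonneg (measurableSet_shell hUopen hUc _ _) fun x hx => hu_nonneg x hx.1
  have hstep : ∀ s t : ℝ, ρm < s → s ≤ t → (t : EReal) < ρM →
      ENNReal.ofReal (m s / Φ s) * ∫⁻ r in Ioo s t, (ENNReal.ofReal (H r))⁻¹ ≤
        ENNReal.ofReal (∫ x in {x ∈ 𝒰 | s ≤ U x ∧ U x < t}, u x) := by
    intro s t hs hst ht
    have hid : ∀ φ ψ θ : ℝ → ℝ, (∀ r, HasDerivAt φ (ψ r) r) → (∀ r, HasDerivAt ψ (θ r) r) →
        Continuous θ → (∀ r, t < r → φ r = 0) →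
        (∫ x in 𝒰, (ψ (U x) * D x + θ (U x) * W x)) = 0 := by
      intro φ ψ θ hφ hψ hθ hφt
      rw [← integral_comp_level_eq_zero hUopen hac hV_cont huc hu_stat hU_C2 (hU_cpt t ht) hφ hψ
        hθ hφt]
      refine integral_congr_ae (Eventually.of_forall fun x => ?_)
      simp only [D, W]
      ring
    refine ofReal_mul_lintegral_inv_le hUopen hUc hWc hW0 huc hu_nonneg (hU_cpt t ht)
      (fun g hg hg0 hgs hgt => ?_) (hΦpos s hs (lt_top hst ht)) hH_meas
      (fun r hr => hH_pos r (hs.trans hr.1) (lt_top hr.2.le ht))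
      fun x hx => mul_le_mul_of_nonneg_right (hH_up x hx) (hu_nonneg x hx)
    exact shell_mul_integral_le hUopen hUc hWc hDc huc hD0
      (fun r hr => hU_cpt r (lt_top hr ht)) hid hs hst
      (hh_cont.mono fun r hr => ⟨hr.1, lt_top (hr.2.trans hst) ht⟩)
      (fun r hr => hh_pos r hr.1 (lt_top (hr.2.trans hst) ht))
      (fun x hx _ _ => mul_le_mul_of_nonneg_right (hh_low x hx) (hu_nonneg x hx)) hg hg0 hgs hgt
  intro ρ0 ρ hρ0 hρ hρM
  change m ρ0 * Real.exp (∫ t in ρ0..ρ, 1 / (H t * Φ t)) ≤ m ρ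
  have hHΦ : ∀ t ∈ Icc ρ0 ρ, 0 < H t * Φ t := fun t ht =>
    mul_pos (hH_pos t (hρ0.trans_le ht.1) (lt_top ht.2 hρM))
      (hΦpos t (hρ0.trans_le ht.1) (lt_top ht.2 hρM))
  by_cases hint : IntervalIntegrable (fun t => 1 / (H t * Φ t)) volume ρ0 ρ
  · refine mul_exp_integral_le hρ hint (fun t ht => (one_div_pos.2 (hHΦ t ht)).le) (hm0 _) ?_
    intro s t hs hst ht
    have hsm : ρm < s := hρ0.trans_le hs
    have htM : (t : EReal) < ρM := lt_top ht hρM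
    have hΦs : 0 < Φ s := hΦpos s hsm (lt_top hst htM)
    rw [hsplit s t hsm.le hst htM, mul_add, mul_one]
    refine add_le_add le_rfl ?_
    rw [← ENNReal.ofReal_le_ofReal_iff (hsh0 s t)]
    refine le_trans ?_ (hstep s t hsm hst htM)
    have hi : IntegrableOn (fun t => 1 / (H t * Φ t)) (Ioo s t) volume :=
      ((intervalIntegrable_iff_integrableOn_Ioo_of_le hρ).1 hint).mono_set
        (Ioo_subset_Ioo hs ht)
    rw [intervalIntegral.integral_of_le hst, integral_Ioc_eq_integral_Ioo,
      ENNReal.ofReal_mul (hm0 s), ofReal_integral_eq_lintegral_ofReal hi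
        ((ae_restrict_mem measurableSet_Ioo).mono fun r hr =>
          (one_div_pos.2 (hHΦ r ⟨hs.trans hr.1.le, hr.2.le.trans ht⟩)).le),
      div_eq_mul_inv, ENNReal.ofReal_mul (hm0 s), mul_assoc]
    refine mul_le_mul_right ?_ _
    rw [← lintegral_const_mul (f := fun r => (ENNReal.ofReal (H r))⁻¹) _
      hH_meas.ennreal_ofReal.inv]
    refine setLIntegral_mono' measurableSet_Ioo fun r hr => ?_
    have hHr : 0 < H r := hH_pos r (hsm.trans hr.1) (lt_top hr.2.le htM)
    rw [← ENNReal.ofReal_inv_of_pos hHr, ← ENNReal.ofReal_mul (inv_nonneg.2 hΦs.le)]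
    refine ENNReal.ofReal_le_ofReal ?_
    rw [one_div, mul_inv, mul_comm]
    refine mul_le_mul_of_nonneg_right ?_ (inv_nonneg.2 hHr.le)
    exact inv_anti₀ hΦs (hΦmono s r hsm.le hr.1.le (lt_top hr.2.le htM))
  · rw [intervalIntegral.integral_undef hint, Real.exp_zero, mul_one,
      hsplit ρ0 ρ hρ0.le hρ hρM]
    exact le_add_of_nonneg_right (hsh0 _ _)
end
end

section
/- (Lemma 3.1) Let U be a continuous compact function in 𝒰 with essential upper bound ρ_M, let 0 < ρ < ρ* < ρ_M, and let U_k : 𝒰 → ℝ (k = 1, 2, ...) be continuous functions converging to U uniformly on the compact set {x ∈ 𝒰 : U(x) ≤ ρ*}. For each k define Ω^k_ρ = {x ∈ Ω_{ρ*} : either U_k(x) < ρ, or U_k(x) = ρ and x is a local maximum point of U_k}. Then there exists a positive integer K such that for every k ≥ K the closure of Ω^k_ρ is contained in Ω_{ρ*} (in particular Ω^k_ρ is compactly contained in Ω_{ρ*}). -/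
open MeasureTheory

noncomputable section

/-- **Lemma 3.1**: for Morse-type approximations `Uₖ → U` uniformly on `{U ≤ ρ*}`, the
modified sublevel sets `Ωᵏ_ρ` are eventually compactly contained in `Ω_{ρ*}`. -/
theorem lemma_3_1
    {n : ℕ} (hn : 0 < n)
    (𝒰 : Set (Eucl n)) (hUopen : IsOpen 𝒰) (hUconn : IsConnected 𝒰)
    (U : Eucl n → ℝ) (ρM : EReal) (hU_cont : ContinuousOn U 𝒰)
    (hU_nonneg : ∀ x ∈ 𝒰, 0 ≤ U x)
    (hU_lt : ∀ x ∈ 𝒰, (U x : EReal) < ρM)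
    (hU_sup : ρM = ⨆ x : 𝒰, (U x.1 : EReal))
    (hU_cpt : ∀ ρ : ℝ, (ρ : EReal) < ρM → IsCompact {x ∈ 𝒰 | U x ≤ ρ})
    (ρ ρs : ℝ) (hρ_pos : 0 < ρ) (hρρs : ρ < ρs) (hρsM : (ρs : EReal) < ρM)
    (Uk : ℕ → Eucl n → ℝ) (hUk_cont : ∀ k, ContinuousOn (Uk k) 𝒰)
    (hconv : TendstoUniformlyOn Uk U Filter.atTop {x ∈ 𝒰 | U x ≤ ρs}) :
    ∃ K : ℕ, ∀ k ≥ K,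
      closure {x ∈ {y ∈ 𝒰 | U y < ρs} |
          Uk k x < ρ ∨ (Uk k x = ρ ∧ IsLocalMax (Uk k) x)} ⊆ {y ∈ 𝒰 | U y < ρs} ∧
      IsCompact (closure {x ∈ {y ∈ 𝒰 | U y < ρs} |
          Uk k x < ρ ∨ (Uk k x = ρ ∧ IsLocalMax (Uk k) x)}) := by
  have hε : 0 < (ρs - ρ) / 2 := by linarith
  obtain ⟨K, hK⟩ := Filter.eventually_atTop.1 (Metric.tendstoUniformlyOn_iff.1 hconv _ hε)
  refine ⟨K, fun k hk => ?_⟩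
  have hmid : (((ρ + ρs) / 2 : ℝ) : EReal) < ρM :=
    lt_trans (EReal.coe_lt_coe_iff.2 (by linarith)) hρsM
  have hcpt := hU_cpt _ hmid
  have hsub : {x ∈ {y ∈ 𝒰 | U y < ρs} |
      Uk k x < ρ ∨ (Uk k x = ρ ∧ IsLocalMax (Uk k) x)} ⊆ {x ∈ 𝒰 | U x ≤ (ρ + ρs) / 2} := by
    rintro x ⟨⟨hx, hxs⟩, hxk⟩
    have hle : Uk k x ≤ ρ := hxk.elim le_of_lt fun h => h.1.le
    have hd := hK k hk x ⟨hx, hxs.le⟩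
    rw [Real.dist_eq] at hd
    have hlt := (abs_lt.1 hd).2
    exact ⟨hx, by linarith⟩
  have hcl := closure_minimal hsub hcpt.isClosed
  refine ⟨fun x hx => ⟨(hcl hx).1, ?_⟩, hcpt.of_isClosed_subset isClosed_closure hcl⟩
  have hxle := (hcl hx).2
  linarith
end
end
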